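/- For the second-order Gaussian kernel and a standard normal target distribution, the exact integrated squared bias of the kernel distribution function estimator with bandwidth h > 0 is ISB(h) = (1/√(2π))·( −√(2h²+2) + 2√(h²+2) − √2 ), and ISB(h) ≥ 0 for all h ≥ 0 with equality iff h = 0. -/

import Mathlib

open Real MeasureTheory

noncomputable def stdNormalPDF (x : ℝ) : ℝ := (Real.sqrt (2 * Real.pi))⁻¹ * Real.exp (-x ^ 2 / 2)

noncomputable def stdNormalCDF (x : ℝ) : ℝ := ∫ u in Set.Iic x, stdNormalPDF u


lemma pdf_eq_gaussian : stdNormalPDF = ProbabilityTheory.gaussianPDFReal 0 1 := by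
  funext x
  simp [stdNormalPDF, ProbabilityTheory.gaussianPDFReal]

lemma pdf_continuous : Continuous stdNormalPDF := by
  unfold stdNormalPDF
  fun_prop

lemma pdf_integrable : Integrable stdNormalPDF := by
  rw [pdf_eq_gaussian]
  exact ProbabilityTheory.integrable_gaussianPDFReal 0 1

lemma pdf_nonneg (x : ℝ) : 0 ≤ stdNormalPDF x := by
  unfold stdNormalPDF
  positivity

lemma cdf_nonneg (x : ℝ) : 0 ≤ stdNormalCDF x :=
  setIntegral_nonneg measurableSet_Iic (fun u _ => pdf_nonneg u)

lemma cdf_hasDerivAt (x : ℝ) : HasDerivAt stdNormalCDF (stdNormalPDF x) x := by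
  have h1 : stdNormalCDF = fun u => stdNormalCDF 0 + ∫ t in (0:ℝ)..u, stdNormalPDF t := by
    funext u
    have := intervalIntegral.integral_Iic_sub_Iic (μ := volume) (f := stdNormalPDF) (a := 0) (b := u)
      pdf_integrable.integrableOn pdf_integrable.integrableOn
    unfold stdNormalCDF
    linarith
  rw [h1]
  exact ((pdf_continuous.integral_hasStrictDerivAt 0 x).hasDerivAt).const_add _

lemma cdf_continuous : Continuous stdNormalCDF :=
  continuous_iff_continuousAt.2 fun x => (cdf_hasDerivAt x).continuousAt

lemma gaussian_Iic (c : ℝ) (hc : 0 < c) (x : ℝ) :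
    ProbabilityTheory.gaussianReal 0 (.mk (c ^ 2) (sq_nonneg _)) (Set.Iic x)
      = ENNReal.ofReal (stdNormalCDF (x / c)) := by
  have h1 := ProbabilityTheory.gaussianReal_map_const_mul (μ := 0) (v := 1) c
  rw [mul_zero, mul_one] at h1
  rw [← h1, Measure.map_apply (by fun_prop) measurableSet_Iic]
  have h2 : (fun y => c * y) ⁻¹' Set.Iic x = Set.Iic (x / c) := by
    ext y
    simp [le_div_iff₀ hc, mul_comm]
  rw [h2, ProbabilityTheory.gaussianReal_apply_eq_integral 0 one_ne_zero, ← pdf_eq_gaussian]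
  rfl

lemma smoothed_cdf (h : ℝ) (hh : 0 < h) (x : ℝ) :
    (∫ y : ℝ, stdNormalCDF ((x - y) / h) * stdNormalPDF y)
      = stdNormalCDF (x / √(1 + h ^ 2)) := by
  have hs : 0 < √(1 + h ^ 2) := by positivity
  have e1 : (∫ y : ℝ, stdNormalCDF ((x - y) / h) * stdNormalPDF y)
      = ∫ y, stdNormalCDF ((x - y) / h) ∂(ProbabilityTheory.gaussianReal 0 1) := by
    rw [ProbabilityTheory.integral_gaussianReal_eq_integral_smul one_ne_zero, ← pdf_eq_gaussian]
    simp only [smul_eq_mul, mul_comm]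
  have hcont : Continuous fun y => stdNormalCDF ((x - y) / h) :=
    cdf_continuous.comp (by fun_prop)
  rw [e1, integral_eq_lintegral_of_nonneg_ae (Filter.Eventually.of_forall fun y => cdf_nonneg _)
    hcont.aestronglyMeasurable]
  have e2 := congrArg (fun m : Measure ℝ => m (Set.Iic x))
    (ProbabilityTheory.gaussianReal_conv_gaussianReal (m₁ := 0) (m₂ := 0) (v₁ := 1)
      (v₂ := .mk (h ^ 2) (sq_nonneg _)))
  have e3 : (1 + NNReal.mk (h ^ 2) (sq_nonneg _)) = NNReal.mk (√(1 + h ^ 2) ^ 2) (sq_nonneg _) := by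
    apply NNReal.coe_injective
    simp only [NNReal.coe_add, NNReal.coe_one, NNReal.coe_mk]
    rw [Real.sq_sqrt (by positivity)]
  simp only [add_zero] at e2
  rw [e3, gaussian_Iic _ hs, Measure.conv, Measure.map_apply (by fun_prop) measurableSet_Iic,
    Measure.prod_apply (measurableSet_Iic.preimage (by fun_prop))] at e2
  have e4 : ∀ y : ℝ, ProbabilityTheory.gaussianReal 0 (.mk (h ^ 2) (sq_nonneg _))
      (Prod.mk y ⁻¹' ((fun z : ℝ × ℝ => z.1 + z.2) ⁻¹' Set.Iic x))
      = ENNReal.ofReal (stdNormalCDF ((x - y) / h)) := by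
    intro y
    rw [← gaussian_Iic h hh]
    congr 1
    ext z
    simp only [Set.mem_preimage, Set.mem_Iic]
    constructor <;> intro _ <;> linarith
  simp only [e4] at e2
  rw [e2, ENNReal.toReal_ofReal (cdf_nonneg _)]

lemma pow_gauss_integrable (b : ℝ) (hb : 0 < b) (n : ℕ) :
    Integrable fun x : ℝ => |x| ^ n * exp (-b * x ^ 2) := by
  have h1 := (integrable_rpow_mul_exp_neg_mul_sq hb (s := (n:ℝ))
    (by have : (0:ℝ) ≤ n := Nat.cast_nonneg n
        linarith)).norm
  refine h1.congr (Filter.Eventually.of_forall fun x => ?_)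
  simp [Real.rpow_natCast, abs_mul, abs_pow]

lemma norm_const_le_one : (√(2 * π))⁻¹ ≤ 1 := by
  apply inv_le_one_of_one_le₀
  rw [Real.one_le_sqrt]
  linarith [Real.pi_gt_three]

lemma pdf_le_exp (x : ℝ) : stdNormalPDF x ≤ exp (-x ^ 2 / 2) := by
  unfold stdNormalPDF
  exact mul_le_of_le_one_left (exp_pos _).le norm_const_le_one

lemma pdf_le_one (x : ℝ) : stdNormalPDF x ≤ 1 := by
  refine (pdf_le_exp x).trans (Real.exp_le_one_iff.2 ?_)
  have := sq_nonneg x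
  linarith

lemma pdf_hasDerivAt (x : ℝ) : HasDerivAt stdNormalPDF (-x * stdNormalPDF x) x := by
  unfold stdNormalPDF
  have h1 : HasDerivAt (fun x : ℝ => -x ^ 2 / 2) (-x) x := by
    refine (((hasDerivAt_pow 2 x).neg).div_const 2).congr_deriv ?_
    norm_num
    try ring
  refine ((h1.exp).const_mul ((√(2 * π))⁻¹)).congr_deriv ?_
  ring

lemma cdf_diff_bound (s : ℝ) (hs : 1 ≤ s) (x : ℝ) :
    |stdNormalCDF (x / s) - stdNormalCDF x| ≤ |x| * exp (-(1 / (2 * s ^ 2)) * x ^ 2) := by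
  have hs0 : 0 < s := by linarith
  have key : ‖stdNormalCDF (x / s) - stdNormalCDF x‖
      ≤ exp (-(1 / (2 * s ^ 2)) * x ^ 2) * ‖x / s - x‖ := by
    refine Convex.norm_image_sub_le_of_norm_hasDerivWithin_le (s := Set.uIcc x (x / s))
      (f' := stdNormalPDF)
      (fun u _ => (cdf_hasDerivAt u).hasDerivWithinAt) ?_ (convex_uIcc _ _)
      Set.left_mem_uIcc Set.right_mem_uIcc
    intro u hu
    rw [Real.norm_of_nonneg (pdf_nonneg u)]
    refine (pdf_le_exp u).trans (exp_le_exp.2 ?_)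
    have hsq : (x / s) ^ 2 ≤ u ^ 2 := by
      rcases le_total 0 x with hx | hx
      · have h1 : x / s ≤ x := div_le_self hx hs
        rw [Set.uIcc_of_ge h1] at hu
        exact pow_le_pow_left₀ (by positivity) hu.1 2
      · have h1 : x ≤ x / s := by
          rw [le_div_iff₀ hs0]
          nlinarith
        rw [Set.uIcc_of_le h1] at hu
        have h2 : x / s ≤ 0 := div_nonpos_of_nonpos_of_nonneg hx hs0.le
        nlinarith [hu.2]
    have : -(1 / (2 * s ^ 2)) * x ^ 2 = -(x / s) ^ 2 / 2 := by
      field_simp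
    rw [this]
    linarith
  rw [Real.norm_eq_abs, Real.norm_eq_abs] at key
  have h3 : |x / s - x| ≤ |x| := by
    have e : x / s - x = -(x * (1 - 1 / s)) := by ring
    have h4 : 1 / s ≤ 1 := by
      rw [div_le_one hs0]; exact hs
    have h5 : 0 < 1 / s := by positivity
    rw [e, abs_neg, abs_mul, abs_of_nonneg (by linarith : 0 ≤ 1 - 1 / s)]
    exact mul_le_of_le_one_right (abs_nonneg x) (by linarith)
  calc _ ≤ _ := key
    _ ≤ exp (-(1 / (2 * s ^ 2)) * x ^ 2) * |x| := by gcongr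
    _ = _ := mul_comm _ _

lemma product_expand (s : ℝ) (hs : 0 < s) (x : ℝ) :
    (stdNormalPDF (x / s) / s - stdNormalPDF x) * (s * stdNormalPDF (x / s) - stdNormalPDF x)
      = (2 * π)⁻¹ * (exp (-(1 / s ^ 2) * x ^ 2) + exp (-1 * x ^ 2)
        - (s + 1 / s) * exp (-((1 + s ^ 2) / (2 * s ^ 2)) * x ^ 2)) := by
  have e1 : exp (-(1 / s ^ 2) * x ^ 2) = exp (-(x / s) ^ 2 / 2) * exp (-(x / s) ^ 2 / 2) := by
    rw [← exp_add]; congr 1; field_simp; ring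
  have e2 : exp (-1 * x ^ 2) = exp (-x ^ 2 / 2) * exp (-x ^ 2 / 2) := by
    rw [← exp_add]; congr 1; ring
  have e3 : exp (-((1 + s ^ 2) / (2 * s ^ 2)) * x ^ 2)
      = exp (-(x / s) ^ 2 / 2) * exp (-x ^ 2 / 2) := by
    rw [← exp_add]; congr 1; field_simp; ring
  have e4 : (2 * π)⁻¹ = (√(2 * π))⁻¹ * (√(2 * π))⁻¹ := by
    rw [← mul_inv, Real.mul_self_sqrt (by positivity)]
  rw [e1, e2, e3, e4]
  unfold stdNormalPDF
  field_simp
  ring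

lemma product_integral (s : ℝ) (hs : 0 < s) :
    Integrable (fun x => (stdNormalPDF (x / s) / s - stdNormalPDF x)
      * (s * stdNormalPDF (x / s) - stdNormalPDF x)) ∧
    ∫ x, (stdNormalPDF (x / s) / s - stdNormalPDF x)
      * (s * stdNormalPDF (x / s) - stdNormalPDF x)
      = (2 * π)⁻¹ * (s * √π + √π - √(1 + s ^ 2) * √(2 * π)) := by
  simp only [product_expand s hs]
  have i1 : Integrable fun x : ℝ => exp (-(1 / s ^ 2) * x ^ 2) :=
    integrable_exp_neg_mul_sq (by positivity)
  have i2 : Integrable fun x : ℝ => exp (-1 * x ^ 2) :=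
    integrable_exp_neg_mul_sq (by positivity)
  have i3 : Integrable fun x : ℝ =>
      (s + 1 / s) * exp (-((1 + s ^ 2) / (2 * s ^ 2)) * x ^ 2) :=
    (integrable_exp_neg_mul_sq (by positivity)).const_mul _
  refine ⟨((i1.add i2).sub i3).const_mul _, ?_⟩
  have i12 : Integrable fun x : ℝ => exp (-(1 / s ^ 2) * x ^ 2) + exp (-1 * x ^ 2) := i1.add i2
  rw [integral_const_mul, integral_sub i12 i3, integral_add i1 i2, integral_const_mul,
    integral_gaussian, integral_gaussian, integral_gaussian]
  have e1 : √(π / (1 / s ^ 2)) = s * √π := by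
    rw [div_div_eq_mul_div, div_one, Real.sqrt_mul (by positivity), Real.sqrt_sq hs.le, mul_comm]
  have e3 : √(π / ((1 + s ^ 2) / (2 * s ^ 2))) = s * √(2 * π) / √(1 + s ^ 2) := by
    have : π / ((1 + s ^ 2) / (2 * s ^ 2)) = s ^ 2 * (2 * π) / (1 + s ^ 2) := by
      field_simp
    rw [this, Real.sqrt_div (by positivity), Real.sqrt_mul (by positivity), Real.sqrt_sq hs.le]
  rw [e1, e3, div_one]
  have h4 : √(1 + s ^ 2) ^ 2 = 1 + s ^ 2 := Real.sq_sqrt (by positivity)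
  have h5 : 0 < √(1 + s ^ 2) := by positivity
  have h6 : (s + 1 / s) * (s * √(2 * π) / √(1 + s ^ 2)) = √(1 + s ^ 2) * √(2 * π) := by
    field_simp
    rw [h4]; ring
  rw [h6]

lemma sq_diff_integral (s : ℝ) (hs : 1 ≤ s) :
    ∫ x, (stdNormalCDF (x / s) - stdNormalCDF x) ^ 2
      = -2 * ((2 * π)⁻¹ * (s * √π + √π - √(1 + s ^ 2) * √(2 * π))) := by
  have hs0 : 0 < s := by linarith
  set b : ℝ := 1 / (2 * s ^ 2) with hb
  have hb0 : 0 < b := by positivity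
  obtain ⟨hi, hv⟩ := product_integral s hs0
  have hD := cdf_diff_bound s hs
  have cD : Continuous fun x => stdNormalCDF (x / s) - stdNormalCDF x :=
    (cdf_continuous.comp (by fun_prop)).sub cdf_continuous
  have cK : Continuous fun x => s * stdNormalPDF (x / s) - stdNormalPDF x :=
    ((pdf_continuous.comp (by fun_prop)).const_mul s).sub pdf_continuous
  have hexp : ∀ x : ℝ, exp (-b * x ^ 2) ≤ 1 := fun x =>
    Real.exp_le_one_iff.2 (by nlinarith [sq_nonneg x])
  have hD2 : ∀ x, (stdNormalCDF (x / s) - stdNormalCDF x) ^ 2 ≤ |x| ^ 2 * exp (-b * x ^ 2) := by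
    intro x
    rw [← sq_abs]
    calc _ ≤ (|x| * exp (-b * x ^ 2)) ^ 2 := pow_le_pow_left₀ (abs_nonneg _) (hD x) 2
      _ = |x| ^ 2 * exp (-b * x ^ 2) * exp (-b * x ^ 2) := by ring
      _ ≤ _ := mul_le_of_le_one_right (by positivity) (hexp x)
  have iD2 : Integrable fun x => (stdNormalCDF (x / s) - stdNormalCDF x) ^ 2 := by
    refine (pow_gauss_integrable b hb0 2).mono' (cD.pow 2).aestronglyMeasurable
      (Filter.Eventually.of_forall fun x => ?_)
    rw [Real.norm_of_nonneg (sq_nonneg _)]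
    exact hD2 x
  have ixD2 : Integrable fun x => x * (stdNormalCDF (x / s) - stdNormalCDF x) ^ 2 := by
    refine (pow_gauss_integrable b hb0 3).mono' (continuous_id.mul (cD.pow 2)).aestronglyMeasurable
      (Filter.Eventually.of_forall fun x => ?_)
    rw [norm_mul, Real.norm_of_nonneg (sq_nonneg _), Real.norm_eq_abs]
    calc _ ≤ |x| * (|x| ^ 2 * exp (-b * x ^ 2)) := by gcongr; exact hD2 x
      _ = _ := by ring
  have iDK : Integrable fun x => (stdNormalCDF (x / s) - stdNormalCDF x)
      * (s * stdNormalPDF (x / s) - stdNormalPDF x) := by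
    refine ((pow_gauss_integrable b hb0 1).mul_const (s + 1)).mono' (cD.mul cK).aestronglyMeasurable
      (Filter.Eventually.of_forall fun x => ?_)
    rw [norm_mul, Real.norm_eq_abs, Real.norm_eq_abs, pow_one]
    have hK : |s * stdNormalPDF (x / s) - stdNormalPDF x| ≤ s + 1 := by
      have h1 := pdf_nonneg x
      have h2 := pdf_le_one x
      have h3 := pdf_nonneg (x / s)
      have h4 := pdf_le_one (x / s)
      rw [abs_le]
      constructor <;> nlinarith
    exact mul_le_mul (hD x) hK (abs_nonneg _) (by positivity)
  have hderiv : ∀ x, HasDerivAt (fun x => x * (stdNormalCDF (x / s) - stdNormalCDF x) ^ 2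
      + 2 * ((stdNormalCDF (x / s) - stdNormalCDF x)
        * (s * stdNormalPDF (x / s) - stdNormalPDF x)))
      ((stdNormalCDF (x / s) - stdNormalCDF x) ^ 2
        + 2 * ((stdNormalPDF (x / s) / s - stdNormalPDF x)
          * (s * stdNormalPDF (x / s) - stdNormalPDF x))) x := by
    intro x
    have d0 : HasDerivAt (fun x : ℝ => x / s) (1 / s) x := (hasDerivAt_id x).div_const s
    have d1 : HasDerivAt (fun x => stdNormalCDF (x / s) - stdNormalCDF x)
        (stdNormalPDF (x / s) * (1 / s) - stdNormalPDF x) x :=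
      (HasDerivAt.comp (h₂ := stdNormalCDF) x (cdf_hasDerivAt (x / s)) d0).sub (cdf_hasDerivAt x)
    have d2 : HasDerivAt (fun x => s * stdNormalPDF (x / s) - stdNormalPDF x)
        (s * (-(x / s) * stdNormalPDF (x / s) * (1 / s)) - -x * stdNormalPDF x) x :=
      ((HasDerivAt.comp (h₂ := stdNormalPDF) x (pdf_hasDerivAt (x / s)) d0).const_mul s).sub
        (pdf_hasDerivAt x)
    have d3 := ((hasDerivAt_id x).mul (d1.pow 2)).add ((d1.mul d2).const_mul 2)
    refine d3.congr_deriv ?_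
    simp
    field_simp
    ring
  have hz := integral_eq_zero_of_hasDerivAt_of_integrable hderiv (iD2.add (hi.const_mul 2))
    (ixD2.add (iDK.const_mul 2))
  rw [integral_add iD2 (hi.const_mul 2), integral_const_mul, hv] at hz
  linarith

/-- Integrated squared bias of the second-order Gaussian KDFE for a standard normal target:
    ISB(h) = ∫ ( E[Φ((x−X)/h)] − Φ(x) )² dx with X ~ N(0,1), together with the
    nonnegativity of the closed form:  2√(h²+2) ≥ √(2h²+2) + √2 for h ≥ 0, with equality
    iff h = 0. -/
theorem exact_ISB_gaussian_kernel_normal :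
    (∀ h : ℝ, 0 < h →
      (∫ x : ℝ, ((∫ y : ℝ, stdNormalCDF ((x - y) / h) * stdNormalPDF y) - stdNormalCDF x) ^ 2)
        = (Real.sqrt (2 * Real.pi))⁻¹ *
            (-Real.sqrt (2 * h ^ 2 + 2) + 2 * Real.sqrt (h ^ 2 + 2) - Real.sqrt 2)) ∧
    (∀ h : ℝ, 0 ≤ h →
      (Real.sqrt (2 * h ^ 2 + 2) + Real.sqrt 2 ≤ 2 * Real.sqrt (h ^ 2 + 2) ∧
        (2 * Real.sqrt (h ^ 2 + 2) = Real.sqrt (2 * h ^ 2 + 2) + Real.sqrt 2 ↔ h = 0))) := by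
  constructor
  · intro h hh
    simp only [smoothed_cdf h hh]
    have hs1 : 1 ≤ √(1 + h ^ 2) := by
      rw [Real.one_le_sqrt]
      nlinarith [sq_nonneg h]
    rw [sq_diff_integral _ hs1, Real.sq_sqrt (by positivity)]
    have e1 : √(2 * h ^ 2 + 2) = √2 * √(1 + h ^ 2) := by
      rw [← Real.sqrt_mul (by norm_num)]
      congr 1
      ring
    have e2 : √(1 + (1 + h ^ 2)) = √(h ^ 2 + 2) := by
      congr 1
      ring
    rw [e1, e2, Real.sqrt_mul (by norm_num : (0:ℝ) ≤ 2)]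
    have h2 : √2 ^ 2 = (2:ℝ) := Real.sq_sqrt (by norm_num)
    have hp : √π ^ 2 = π := Real.sq_sqrt pi_pos.le
    have p2 : 0 < √(2:ℝ) := by positivity
    have pp : 0 < √π := by positivity
    generalize √(1 + h ^ 2) = s
    generalize √(h ^ 2 + 2) = t
    generalize √(2:ℝ) = a at *
    generalize √π = c at *
    rw [← hp, ← h2]
    field_simp
    try ring
  · intro h hh
    have ha : √(2 * h ^ 2 + 2) ^ 2 = 2 * h ^ 2 + 2 := Real.sq_sqrt (by positivity)
    have hb : √2 ^ 2 = (2:ℝ) := Real.sq_sqrt (by norm_num)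
    have hc : √(h ^ 2 + 2) ^ 2 = h ^ 2 + 2 := Real.sq_sqrt (by positivity)
    have a0 := Real.sqrt_nonneg (2 * h ^ 2 + 2)
    have b0 := Real.sqrt_nonneg 2
    have c0 := Real.sqrt_nonneg (h ^ 2 + 2)
    refine ⟨?_, ?_, ?_⟩
    · apply abs_le_of_sq_le_sq' _ (by positivity) |>.2
      nlinarith [sq_nonneg (√(2 * h ^ 2 + 2) - √2)]
    · intro he
      have h1 : (√(2 * h ^ 2 + 2) - √2) ^ 2 = 0 := by
        have := congrArg (fun z => z ^ 2) he
        nlinarith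
      have h2 : √(2 * h ^ 2 + 2) = √2 := by
        have := pow_eq_zero_iff (two_ne_zero) |>.1 h1
        linarith
      rw [h2] at ha
      have : h ^ 2 = 0 := by linarith
      exact pow_eq_zero_iff (two_ne_zero) |>.1 this
    · rintro rfl
      norm_num
      ring
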